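/- arXiv:1503.08350 — 4 statements merged into one kernel-verified Lean document; each statement's English description precedes it below -/
import Mathlib

section
/- Let Z and V be nonzero finite-dimensional real inner product spaces and let k : Z → End(V) be a linear map satisfying ‖k(a)x‖ = ‖a‖·‖x‖ and k(a)² = −‖a‖²·Id_V for all a ∈ Z, x ∈ V. Define a bracket on n = Z ⊕ V by [a + x, b + y] := the unique element c ∈ Z with ⟨c, a'⟩ = ⟨k(a')x, y⟩ for all a' ∈ Z (a, b ∈ Z, x, y ∈ V). Then this bracket is well defined, bilinear, alternating, and satisfies the Jacobi identity, so that n is a real Lie algebra (a Lie algebra of type H). -/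
/-! Lie algebras of type H: for nonzero finite-dimensional real inner product spaces `Z`, `V`
and a linear map `k : Z → End(V)` with `‖k(a)x‖ = ‖a‖‖x‖` and `k(a)² = -‖a‖²·Id`, the bracket
on `n = Z ⊕ V` determined by `⟨[a+x, b+y], a'⟩ = ⟨k(a')x, y⟩` (with values in `Z`) is well
defined (exists and is unique), bilinear, alternating and satisfies the Jacobi identity. -/

open scoped RealInnerProductSpace

/-- An operator `T` with `‖T x‖ = r ‖x‖` and `T² = -r²` maps every vector to an orthogonal one. -/
theorem inner_apply_self_eq_zero_of_norm_of_sq {V : Type*}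
    [NormedAddCommGroup V] [InnerProductSpace ℝ V] (T : V →ₗ[ℝ] V) (r : ℝ)
    (hnorm : ∀ x, ‖T x‖ = r * ‖x‖) (hsq : ∀ x, T (T x) = (-(r ^ 2)) • x) (x : V) :
    ⟪T x, x⟫ = 0 := by
  rcases eq_or_ne r 0 with rfl | hr
  · have hx : T x = 0 := norm_eq_zero.1 (by simp [hnorm])
    simp [hx]
  · have h := congrArg (· ^ 2) (hnorm (T x + x))
    simp only [map_add, hsq, mul_pow, norm_add_sq_real, norm_smul, hnorm, real_inner_smul_left,
      Real.norm_eq_abs, sq_abs, real_inner_comm (T x) x] at h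
    have h' : r ^ 2 * ⟪T x, x⟫ = 0 := by linarith
    exact (mul_eq_zero.1 h').resolve_left (pow_ne_zero 2 hr)

/-- The vector `c` of `Z` determined by `⟪c, a⟫ = ⟪k a x, y⟫` for all `a`. -/
noncomputable def centralBracket {Z V : Type*}
    [NormedAddCommGroup Z] [InnerProductSpace ℝ Z] [FiniteDimensional ℝ Z]
    [NormedAddCommGroup V] [InnerProductSpace ℝ V]
    (k : Z →ₗ[ℝ] V →ₗ[ℝ] V) (x y : V) : Z :=
  haveI := FiniteDimensional.complete ℝ Z
  (InnerProductSpace.toDual ℝ Z).symm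
    (LinearMap.toContinuousLinearMap ((innerₛₗ ℝ y).comp (k.flip x)))

theorem inner_centralBracket {Z V : Type*}
    [NormedAddCommGroup Z] [InnerProductSpace ℝ Z] [FiniteDimensional ℝ Z]
    [NormedAddCommGroup V] [InnerProductSpace ℝ V]
    (k : Z →ₗ[ℝ] V →ₗ[ℝ] V) (x y : V) (a : Z) :
    ⟪centralBracket k x y, a⟫ = ⟪k a x, y⟫ := by
  simp [centralBracket, real_inner_comm]

theorem typeH_bracket_well_defined_lie_algebra
    (Z V : Type*)
    [NormedAddCommGroup Z] [InnerProductSpace ℝ Z] [FiniteDimensional ℝ Z] [Nontrivial Z]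
    [NormedAddCommGroup V] [InnerProductSpace ℝ V] [FiniteDimensional ℝ V] [Nontrivial V]
    (k : Z →ₗ[ℝ] V →ₗ[ℝ] V)
    (hk1 : ∀ (a : Z) (x : V), ‖k a x‖ = ‖a‖ * ‖x‖)
    (hk2 : ∀ a : Z, (k a).comp (k a) = (-(‖a‖ ^ 2) : ℝ) • (LinearMap.id : V →ₗ[ℝ] V)) :
    ∃! B : (Z × V) → (Z × V) → (Z × V),
      -- the bracket takes values in `Z` …
      (∀ u v : Z × V, (B u v).2 = 0) ∧
      -- … and its `Z`-component is characterised by `⟨[u, v], a'⟩ = ⟨k(a') u_V, v_V⟩`: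
      (∀ u v : Z × V, ∀ a' : Z, ⟪(B u v).1, a'⟫ = ⟪k a' u.2, v.2⟫) ∧
      -- bilinearity:
      (∀ (c : ℝ) (u u' v : Z × V), B (c • u + u') v = c • B u v + B u' v) ∧
      (∀ (c : ℝ) (u v v' : Z × V), B u (c • v + v') = c • B u v + B u v') ∧
      -- alternating:
      (∀ u : Z × V, B u u = 0) ∧
      -- Jacobi identity:
      (∀ u v w : Z × V, B u (B v w) + B v (B w u) + B w (B u v) = 0) := by
  have key : ∀ {c : Z} {x y : V}, (∀ a, ⟪c, a⟫ = ⟪k a x, y⟫) → c = centralBracket k x y :=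
    fun h => ext_inner_right ℝ fun a => by rw [h, inner_centralBracket]
  have hzero_right : ∀ x, centralBracket k x 0 = 0 := fun x => (key (by simp)).symm
  refine ⟨fun u v => (centralBracket k u.2 v.2, 0),
    ⟨fun _ _ => rfl, fun u v a => inner_centralBracket k u.2 v.2 a, ?_, ?_, ?_, ?_⟩, ?_⟩
  · intro c u u' v
    refine Prod.ext (key fun a => ?_).symm (by simp)
    simp [inner_add_left, real_inner_smul_left, inner_centralBracket]
  · intro c u v v'
    refine Prod.ext (key fun a => ?_).symm (by simp)
    simp [inner_add_left, inner_add_right, real_inner_smul_left, real_inner_smul_right,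
      inner_centralBracket]
  · intro u
    refine Prod.ext (key fun a => ?_).symm rfl
    have hsq : ∀ x, k a (k a x) = (-(‖a‖ ^ 2)) • x := fun x => by
      simpa using LinearMap.congr_fun (hk2 a) x
    simp [inner_apply_self_eq_zero_of_norm_of_sq (k a) ‖a‖ (hk1 a) hsq]
  · intro u v w
    simp [hzero_right]
  · rintro B ⟨hB₂, hB₁, -⟩
    funext u v
    exact Prod.ext (key (hB₁ u v)) (hB₂ u v)
end

section
/- For each i = 1, 2, 3, the almost contact structure (φᵢ, ξᵢ, ηᵢ) on n_p is normal: the Nijenhuis-type tensor Nᵢ(X, Y) := [φᵢX, φᵢY] + φᵢ²([X, Y]) − φᵢ([φᵢX, Y]) − φᵢ([X, φᵢY]) + dηᵢ(X, Y)·ξᵢ vanishes for all X, Y ∈ n_p, where dηᵢ(X, Y) := −ηᵢ([X, Y]). -/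
/-! Common setup: the quaternionic Heisenberg Lie algebra `n_p` of dimension `4p+3`,
realised as `ℝ^{4p+3}` with orthonormal basis `ξ₁ ξ₂ ξ₃ τ₁ … τ_{4p}`. -/

noncomputable section

open scoped BigOperators

/-- The underlying vector space of the quaternionic Heisenberg Lie algebra `n_p`. -/
abbrev NV (p : ℕ) : Type := Fin (4 * p + 3) → ℝ

/-- The inner product `g_λ` for which the standard basis is orthonormal. -/
def gIP {p : ℕ} (X Y : NV p) : ℝ := ∑ a, X a * Y a

/-- Index of the basis vector `ξ_{i+1}`, `i = 0, 1, 2`. -/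
def zI (p : ℕ) (i : Fin 3) : Fin (4 * p + 3) := ⟨i.val, by have := i.isLt; omega⟩

/-- Index of the basis vector `τ_{ip + r + 1}`, `i = 0, 1, 2, 3`, `r = 0, …, p-1`. -/
def tI (p : ℕ) (i : Fin 4) (r : Fin p) : Fin (4 * p + 3) :=
  ⟨3 + i.val * p + r.val, by
    have h1 := i.isLt; have h2 := r.isLt
    have h3 : i.val * p ≤ 3 * p := Nat.mul_le_mul_right p (by omega)
    omega⟩

/-- The basis vector `ξ_{i+1}`. -/
def xi (p : ℕ) (i : Fin 3) : NV p := Pi.single (zI p i) 1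

/-- The basis vector `τ_{ip + r + 1}`. -/
def tau (p : ℕ) (i : Fin 4) (r : Fin p) : NV p := Pi.single (tI p i r) 1

/-- The Lie bracket of `n_p`: the bilinear extension of
`[τ_r, τ_{p+r}] = [τ_{2p+r}, τ_{3p+r}] = λ ξ₁`, `[τ_r, τ_{2p+r}] = [τ_{3p+r}, τ_{p+r}] = λ ξ₂`,
`[τ_r, τ_{3p+r}] = [τ_{p+r}, τ_{2p+r}] = λ ξ₃`, all other brackets of basis vectors being zero. -/
def bracket (p : ℕ) (lam : ℝ) (X Y : NV p) : NV p :=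
  (lam * ∑ r : Fin p,
      (X (tI p 0 r) * Y (tI p 1 r) - X (tI p 1 r) * Y (tI p 0 r)
        + X (tI p 2 r) * Y (tI p 3 r) - X (tI p 3 r) * Y (tI p 2 r))) • xi p 0
  + (lam * ∑ r : Fin p,
      (X (tI p 0 r) * Y (tI p 2 r) - X (tI p 2 r) * Y (tI p 0 r)
        + X (tI p 3 r) * Y (tI p 1 r) - X (tI p 1 r) * Y (tI p 3 r))) • xi p 1
  + (lam * ∑ r : Fin p,
      (X (tI p 0 r) * Y (tI p 3 r) - X (tI p 3 r) * Y (tI p 0 r)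
        + X (tI p 1 r) * Y (tI p 2 r) - X (tI p 2 r) * Y (tI p 1 r))) • xi p 2

/-- `dη_i(X, Y) := -η_i([X, Y])`. -/
def dEta (p : ℕ) (lam : ℝ) (i : Fin 3) (X Y : NV p) : ℝ := -(bracket p lam X Y (zI p i))

/-- The three almost contact endomorphisms `φ₁, φ₂, φ₃` of `n_p`. -/
def phi (p : ℕ) : Fin 3 → NV p → NV p :=
  ![fun X => X (zI p 1) • xi p 2 - X (zI p 2) • xi p 1
      + ∑ r : Fin p, (X (tI p 0 r) • tau p 1 r - X (tI p 1 r) • tau p 0 r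
          + X (tI p 2 r) • tau p 3 r - X (tI p 3 r) • tau p 2 r),
    fun X => X (zI p 2) • xi p 0 - X (zI p 0) • xi p 2
      + ∑ r : Fin p, (X (tI p 0 r) • tau p 2 r - X (tI p 2 r) • tau p 0 r
          + X (tI p 3 r) • tau p 1 r - X (tI p 1 r) • tau p 3 r),
    fun X => X (zI p 0) • xi p 1 - X (zI p 1) • xi p 0
      + ∑ r : Fin p, (X (tI p 0 r) • tau p 3 r - X (tI p 3 r) • tau p 0 r
          + X (tI p 1 r) • tau p 2 r - X (tI p 2 r) • tau p 1 r)]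

/-- `(η_i ∧ η_j)(X, Y)`. -/
def etaWedge (p : ℕ) (i j : Fin 3) (X Y : NV p) : ℝ :=
  X (zI p i) * Y (zI p j) - Y (zI p i) * X (zI p j)

/-- The 2-forms `H₁ = -(1/λ)dη₁ + 2 η₂∧η₃`, `H₂ = -(1/λ)dη₂ - 2 η₁∧η₃`,
`H₃ = -(1/λ)dη₃ + 2 η₁∧η₂`. -/
def Hform (p : ℕ) (lam : ℝ) : Fin 3 → NV p → NV p → ℝ :=
  ![fun X Y => -(1 / lam) * dEta p lam 0 X Y + 2 * etaWedge p 1 2 X Y,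
    fun X Y => -(1 / lam) * dEta p lam 1 X Y - 2 * etaWedge p 0 2 X Y,
    fun X Y => -(1 / lam) * dEta p lam 2 X Y + 2 * etaWedge p 0 1 X Y]

/-- The 2-form `H_i` regarded as an endomorphism of `n_p` via `g_λ(H_i X, Y) = H_i(X, Y)`. -/
def Hend (p : ℕ) (lam : ℝ) (i : Fin 3) (X : NV p) : NV p :=
  fun b => Hform p lam i X (Pi.single b 1)

/-- `(η₁ ∧ η₂ ∧ η₃)(X, Y, Z)`. -/
def det3 (p : ℕ) (X Y Z : NV p) : ℝ :=
  X (zI p 0) * (Y (zI p 1) * Z (zI p 2) - Y (zI p 2) * Z (zI p 1))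
  - Y (zI p 0) * (X (zI p 1) * Z (zI p 2) - X (zI p 2) * Z (zI p 1))
  + Z (zI p 0) * (X (zI p 1) * Y (zI p 2) - X (zI p 2) * Y (zI p 1))

/-- The torsion 3-form `T = η₁∧dη₁ + η₂∧dη₂ + η₃∧dη₃ - 4λ η₁∧η₂∧η₃`. -/
def Tform (p : ℕ) (lam : ℝ) (X Y Z : NV p) : ℝ :=
  (∑ i : Fin 3,
    (X (zI p i) * dEta p lam i Y Z - Y (zI p i) * dEta p lam i X Z
      + Z (zI p i) * dEta p lam i X Y)) - 4 * lam * det3 p X Y Z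

/-- The standard basis vector `e_a` of `n_p`. -/
def basisE (p : ℕ) (a : Fin (4 * p + 3)) : NV p := Pi.single a 1

end

theorem tI_inj {p : ℕ} {i j : Fin 4} {r s : Fin p} : tI p i r = tI p j s ↔ i = j ∧ r = s := by
  refine ⟨fun h => ?_, fun ⟨hij, hrs⟩ => by rw [hij, hrs]⟩
  have hr := r.isLt
  have hs := s.isLt
  have hv : i.val * p + r.val = j.val * p + s.val := by
    have := congrArg Fin.val h
    simp only [tI] at this
    omega
  have hij : i.val = j.val := by
    rcases lt_trichotomy i.val j.val with hlt | heq | hgt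
    · nlinarith
    · exact heq
    · nlinarith
  rw [hij] at hv
  exact ⟨Fin.ext hij, Fin.ext (by omega)⟩

theorem zI_ne_tI {p : ℕ} (i : Fin 3) (j : Fin 4) (r : Fin p) : zI p i ≠ tI p j r := by
  intro h
  have := congrArg Fin.val h
  have := i.isLt
  simp only [zI, tI] at *
  omega

theorem zI_inj {p : ℕ} {i j : Fin 3} : zI p i = zI p j ↔ i = j := by
  simp [zI, Fin.ext_iff]

theorem xi_zI {p : ℕ} (i j : Fin 3) : xi p i (zI p j) = if j = i then 1 else 0 := by
  simp [xi, Pi.single_apply, zI_inj]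

theorem xi_tI {p : ℕ} (i : Fin 3) (j : Fin 4) (r : Fin p) : xi p i (tI p j r) = 0 := by
  simp [xi, (zI_ne_tI i j r).symm]

theorem tau_tI {p : ℕ} (i j : Fin 4) (r s : Fin p) :
    tau p i r (tI p j s) = if j = i then (if s = r then 1 else 0) else 0 := by
  simp [tau, Pi.single_apply, tI_inj, ite_and]

theorem bracket_zI {p : ℕ} (lam : ℝ) (X Y : NV p) (i : Fin 3) :
    bracket p lam X Y (zI p i) = ![
      lam * ∑ r : Fin p, (X (tI p 0 r) * Y (tI p 1 r) - X (tI p 1 r) * Y (tI p 0 r)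
        + X (tI p 2 r) * Y (tI p 3 r) - X (tI p 3 r) * Y (tI p 2 r)),
      lam * ∑ r : Fin p, (X (tI p 0 r) * Y (tI p 2 r) - X (tI p 2 r) * Y (tI p 0 r)
        + X (tI p 3 r) * Y (tI p 1 r) - X (tI p 1 r) * Y (tI p 3 r)),
      lam * ∑ r : Fin p, (X (tI p 0 r) * Y (tI p 3 r) - X (tI p 3 r) * Y (tI p 0 r)
        + X (tI p 1 r) * Y (tI p 2 r) - X (tI p 2 r) * Y (tI p 1 r))] i := by
  fin_cases i <;> simp [bracket, xi_zI]

theorem bracket_eq_sum_xi {p : ℕ} (lam : ℝ) (X Y : NV p) :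
    bracket p lam X Y = bracket p lam X Y (zI p 0) • xi p 0
      + bracket p lam X Y (zI p 1) • xi p 1 + bracket p lam X Y (zI p 2) • xi p 2 := by
  simp only [bracket_zI]
  rfl

theorem phi_vertical {p : ℕ} (i : Fin 3) (a b c : ℝ) :
    phi p i (a • xi p 0 + b • xi p 1 + c • xi p 2) =
      (![0, c, -b] i) • xi p 0 + (![-c, 0, a] i) • xi p 1 + (![b, -a, 0] i) • xi p 2 := by
  fin_cases i <;> simp [phi, xi_zI, xi_tI] <;> abel

theorem phi_tI {p : ℕ} (i : Fin 3) (X : NV p) (j : Fin 4) (r : Fin p) :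
    phi p i X (tI p j r) =
      ![![-X (tI p 1 r), X (tI p 0 r), -X (tI p 3 r), X (tI p 2 r)],
        ![-X (tI p 2 r), X (tI p 3 r), X (tI p 0 r), -X (tI p 1 r)],
        ![-X (tI p 3 r), -X (tI p 2 r), X (tI p 1 r), X (tI p 0 r)]] i j := by
  fin_cases i <;> fin_cases j <;>
    simp [phi, xi_tI, tau_tI, Finset.sum_add_distrib, Finset.sum_sub_distrib]

/-- each almost contact structure `(φᵢ, ξᵢ, ηᵢ)` on `n_p` is normal: the
Nijenhuis-type tensor
`Nᵢ(X,Y) = [φᵢX, φᵢY] + φᵢ²([X,Y]) - φᵢ([φᵢX, Y]) - φᵢ([X, φᵢY]) + dηᵢ(X,Y)·ξᵢ` vanishes. -/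
theorem quaternionic_heisenberg_normal
    (p : ℕ) (hp : 1 ≤ p) (lam : ℝ) (hlam : 0 < lam) :
    ∀ i : Fin 3, ∀ X Y : NV p,
      bracket p lam (phi p i X) (phi p i Y)
        + phi p i (phi p i (bracket p lam X Y))
        - phi p i (bracket p lam (phi p i X) Y)
        - phi p i (bracket p lam X (phi p i Y))
        + dEta p lam i X Y • xi p i = 0 := by
  intro i X Y
  rw [bracket_eq_sum_xi lam (phi p i X) (phi p i Y), bracket_eq_sum_xi lam X Y,
    bracket_eq_sum_xi lam (phi p i X) Y, bracket_eq_sum_xi lam X (phi p i Y)]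
  simp only [phi_vertical, dEta, bracket_zI, phi_tI]
  ext a
  fin_cases i <;>
    simp [Finset.sum_add_distrib, Finset.sum_sub_distrib, Finset.sum_neg_distrib] <;> ring
end

section
/- The Riemannian scalar curvature of the left-invariant metric g_λ on the quaternionic Heisenberg group equals s^g = −3pλ²: let ∇^g : n_p → End(n_p) be defined by the Koszul formula g_λ(∇^g_X Y, Z) = ½[g_λ([X, Y], Z) − g_λ([Y, Z], X) + g_λ([Z, X], Y)], let R^g(X, Y) := ∇^g_X ∘ ∇^g_Y − ∇^g_Y ∘ ∇^g_X − ∇^g_{[X,Y]}, and let (e_a) be the orthonormal basis ξ₁, ξ₂, ξ₃, τ₁, …, τ_{4p}. Then Σ_{a,b} g_λ(R^g(e_a, e_b)e_b, e_a) = −3pλ². -/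
theorem gIP_comm {p : ℕ} (X Y : NV p) : gIP X Y = gIP Y X := by
  simp only [gIP, mul_comm]

theorem gIP_sub_left {p : ℕ} (X Y Z : NV p) : gIP (X - Y) Z = gIP X Z - gIP Y Z := by
  simp only [gIP, Pi.sub_apply, sub_mul, Finset.sum_sub_distrib]

theorem gIP_neg_left {p : ℕ} (X Y : NV p) : gIP (-X) Y = -gIP X Y := by
  simp only [gIP, Pi.neg_apply, neg_mul, Finset.sum_neg_distrib]

theorem gIP_zero_left {p : ℕ} (X : NV p) : gIP 0 X = 0 := by
  simp [gIP]

theorem gIP_basisE_right {p : ℕ} (X : NV p) (a : Fin (4 * p + 3)) :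
    gIP X (basisE p a) = X a := by
  simp [gIP, basisE, Pi.single_apply]

theorem tI_ne_zI {p : ℕ} (i : Fin 4) (r : Fin p) (j : Fin 3) : tI p i r ≠ zI p j := by
  have := j.isLt
  simp only [tI, zI, ne_eq, Fin.ext_iff]
  omega

theorem bijective_sumElim_zI_tI (p : ℕ) :
    Function.Bijective (Sum.elim (zI p) fun x : Fin 4 × Fin p => tI p x.1 x.2) := by
  rw [Fintype.bijective_iff_injective_and_card]
  constructor
  · rintro (i | ⟨i, r⟩) (j | ⟨j, s⟩) h
    · simpa [zI_inj] using h
    · exact absurd h.symm (tI_ne_zI _ _ _)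
    · exact absurd h (tI_ne_zI _ _ _)
    · simpa [tI_inj] using h
  · simp [add_comm]

theorem sum_eq_sum_zI_add_sum_tI {p : ℕ} (f : Fin (4 * p + 3) → ℝ) :
    ∑ a, f a = ∑ i, f (zI p i) + ∑ i, ∑ r, f (tI p i r) := by
  rw [← (bijective_sumElim_zI_tI p).sum_comp, Fintype.sum_sum_type, Fintype.sum_prod_type]
  simp

theorem eq_zI_or_eq_tI {p : ℕ} (a : Fin (4 * p + 3)) :
    (∃ i, a = zI p i) ∨ ∃ i r, a = tI p i r := by
  obtain ⟨i | ⟨i, r⟩, rfl⟩ := (bijective_sumElim_zI_tI p).surjective a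
  · exact Or.inl ⟨i, rfl⟩
  · exact Or.inr ⟨i, r, rfl⟩

theorem bracket_skew {p : ℕ} (lam : ℝ) (X Y : NV p) :
    bracket p lam X Y = -bracket p lam Y X := by
  simp only [bracket, neg_add, ← neg_smul, ← mul_neg, ← Finset.sum_neg_distrib]
  refine congr_arg₂ _ (congr_arg₂ _ ?_ ?_) ?_ <;>
    exact congrArg (fun c => (lam * c) • _) (Finset.sum_congr rfl fun r _ => by ring)

theorem bracket_apply_tI {p : ℕ} (lam : ℝ) (X Y : NV p) (i : Fin 4) (r : Fin p) :
    bracket p lam X Y (tI p i r) = 0 := by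
  simp [bracket, xi, tI_ne_zI]

theorem bracket_eq_zero_of_left {p : ℕ} (lam : ℝ) {X : NV p} (Y : NV p)
    (hX : ∀ i r, X (tI p i r) = 0) : bracket p lam X Y = 0 := by
  simp [bracket, hX]

theorem bracket_bracket_left {p : ℕ} (lam : ℝ) (X Y Z : NV p) :
    bracket p lam (bracket p lam X Y) Z = 0 :=
  bracket_eq_zero_of_left lam Z fun i r => bracket_apply_tI lam X Y i r

theorem bracket_basisE_zI_left {p : ℕ} (lam : ℝ) (i : Fin 3) (Y : NV p) :
    bracket p lam (basisE p (zI p i)) Y = 0 :=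
  bracket_eq_zero_of_left lam Y fun j r => by simp [basisE, tI_ne_zI]

theorem bracket_basisE_zI_right {p : ℕ} (lam : ℝ) (i : Fin 3) (X : NV p) :
    bracket p lam X (basisE p (zI p i)) = 0 := by
  rw [bracket_skew, bracket_basisE_zI_left, neg_zero]

theorem bracket_basisE_apply_self {p : ℕ} (lam : ℝ) (a : Fin (4 * p + 3)) (X : NV p) :
    bracket p lam X (basisE p a) a = 0 := by
  obtain ⟨i, rfl⟩ | ⟨i, r, rfl⟩ := eq_zI_or_eq_tI a
  · rw [bracket_basisE_zI_right, Pi.zero_apply]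
  · exact bracket_apply_tI ..

theorem bracket_basisE_mul_bracket_basisE {p : ℕ} (lam : ℝ) (a b d : Fin (4 * p + 3)) :
    bracket p lam (basisE p b) (basisE p d) a * bracket p lam (basisE p d) (basisE p a) b = 0 := by
  obtain ⟨i, rfl⟩ | ⟨i, r, rfl⟩ := eq_zI_or_eq_tI a
  · rw [bracket_basisE_zI_right, Pi.zero_apply, mul_zero]
  · rw [bracket_apply_tI, zero_mul]

/-- The squared norm of the bracket, summed over all pairs of basis vectors. -/
theorem sum_bracket_basisE_sq (p : ℕ) (lam : ℝ) :
    ∑ a, ∑ b, ∑ d, bracket p lam (basisE p a) (basisE p b) d ^ 2 = 12 * p * lam ^ 2 := by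
  simp only [sum_eq_sum_zI_add_sum_tI, bracket_basisE_zI_left, bracket_basisE_zI_right,
    bracket_apply_tI]
  simp [Fin.sum_univ_three, Fin.sum_univ_four, bracket, xi, basisE, Pi.single_apply, zI_inj,
    tI_inj, Finset.sum_add_distrib, Finset.sum_sub_distrib, ite_pow]
  ring

/-- `LC` satisfies the Koszul formula for the left-invariant metric. -/
def SatisfiesKoszul {p : ℕ} (lam : ℝ) (LC : NV p → NV p → NV p) : Prop :=
  ∀ X Y Z : NV p,
    gIP (LC X Y) Z
      = (gIP (bracket p lam X Y) Z - gIP (bracket p lam Y Z) X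
          + gIP (bracket p lam Z X) Y) / 2

theorem gIP_koszul_skew {p : ℕ} {lam : ℝ} {LC : NV p → NV p → NV p}
    (hKoszul : SatisfiesKoszul lam LC) (X Y Z : NV p) : gIP (LC X Y) Z = -gIP (LC X Z) Y := by
  rw [hKoszul, hKoszul, bracket_skew lam Z Y, bracket_skew lam X Z, bracket_skew lam Y X]
  simp only [gIP_neg_left]
  ring

theorem gIP_koszul_basisE_self {p : ℕ} {lam : ℝ} {LC : NV p → NV p → NV p}
    (hKoszul : SatisfiesKoszul lam LC) (b : Fin (4 * p + 3)) (Z : NV p) :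
    gIP (LC (basisE p b) (basisE p b)) Z = 0 := by
  rw [hKoszul, bracket_skew lam (basisE p b) Z, gIP_neg_left, gIP_basisE_right,
    bracket_basisE_apply_self]
  have h : bracket p lam (basisE p b) (basisE p b) = 0 :=
    self_eq_neg.mp (bracket_skew lam _ _)
  simp [h, gIP_zero_left]

theorem gIP_koszul_bracket {p : ℕ} {lam : ℝ} {LC : NV p → NV p → NV p}
    (hKoszul : SatisfiesKoszul lam LC) (X Y : NV p) :
    gIP (LC (bracket p lam X Y) Y) X = gIP (bracket p lam X Y) (bracket p lam X Y) / 2 := by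
  rw [hKoszul, bracket_bracket_left, bracket_skew lam X (bracket p lam X Y),
    bracket_bracket_left, bracket_skew lam Y X, gIP_neg_left, neg_zero, gIP_zero_left,
    gIP_zero_left]
  ring

theorem gIP_koszul_basisE_swap {p : ℕ} {lam : ℝ} {LC : NV p → NV p → NV p}
    (hKoszul : SatisfiesKoszul lam LC) (a b : Fin (4 * p + 3)) :
    gIP (LC (basisE p a) (basisE p b)) (LC (basisE p b) (basisE p a))
      = ∑ d, (bracket p lam (basisE p d) (basisE p a) b ^ 2
          + bracket p lam (basisE p b) (basisE p d) a ^ 2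
          - bracket p lam (basisE p a) (basisE p b) d ^ 2) / 4 := by
  refine Finset.sum_congr rfl fun d _ => ?_
  rw [← gIP_basisE_right (LC _ _) d, ← gIP_basisE_right (LC (basisE p b) _) d, hKoszul, hKoszul,
    bracket_skew lam (basisE p b) (basisE p a), bracket_skew lam (basisE p a) (basisE p d),
    bracket_skew lam (basisE p d) (basisE p b)]
  simp only [gIP_basisE_right, Pi.neg_apply]
  linear_combination (-1 / 2) * bracket_basisE_mul_bracket_basisE lam a b d

theorem gIP_curvature_basisE {p : ℕ} {lam : ℝ} {LC : NV p → NV p → NV p}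
    (hKoszul : SatisfiesKoszul lam LC) (a b : Fin (4 * p + 3)) :
    gIP (LC (basisE p a) (LC (basisE p b) (basisE p b))
          - LC (basisE p b) (LC (basisE p a) (basisE p b))
          - LC (bracket p lam (basisE p a) (basisE p b)) (basisE p b))
        (basisE p a)
      = ∑ d, (bracket p lam (basisE p d) (basisE p a) b ^ 2
          + bracket p lam (basisE p b) (basisE p d) a ^ 2
          - 3 * bracket p lam (basisE p a) (basisE p b) d ^ 2) / 4 := by
  rw [gIP_sub_left, gIP_sub_left, gIP_koszul_skew hKoszul (basisE p a),
    gIP_koszul_skew hKoszul (basisE p b), gIP_comm (LC (basisE p a) (basisE p a)),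
    gIP_koszul_basisE_self hKoszul, gIP_koszul_bracket hKoszul,
    gIP_comm (LC (basisE p b) (basisE p a)), gIP_koszul_basisE_swap hKoszul, gIP,
    Finset.sum_div, neg_zero, zero_sub, neg_neg, ← Finset.sum_sub_distrib]
  exact Finset.sum_congr rfl fun d _ => by ring

/-- the Riemannian scalar curvature of the left-invariant metric `g_λ` on the
quaternionic Heisenberg group equals `-3pλ²`, where the Levi-Civita connection on
left-invariant fields is given by the Koszul formula and
`R^g(X,Y) = ∇^g_X∇^g_Y - ∇^g_Y∇^g_X - ∇^g_{[X,Y]}`. -/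
theorem quaternionic_heisenberg_riemannian_scalar_curvature
    (p : ℕ) (hp : 1 ≤ p) (lam : ℝ) (hlam : 0 < lam)
    (LC : NV p → NV p → NV p)
    (hKoszul : ∀ X Y Z : NV p,
      gIP (LC X Y) Z
        = (gIP (bracket p lam X Y) Z - gIP (bracket p lam Y Z) X
            + gIP (bracket p lam Z X) Y) / 2) :
    ∑ a, ∑ b,
      gIP (LC (basisE p a) (LC (basisE p b) (basisE p b))
            - LC (basisE p b) (LC (basisE p a) (basisE p b))
            - LC (bracket p lam (basisE p a) (basisE p b)) (basisE p b))
        (basisE p a)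
      = -3 * (p : ℝ) * lam ^ 2 := by
  simp only [gIP_curvature_basisE hKoszul, ← Finset.sum_div, Finset.sum_sub_distrib,
    Finset.sum_add_distrib, ← Finset.mul_sum]
  have hS := sum_bracket_basisE_sq p lam
  have hS₁ : ∑ a, ∑ b, ∑ d, bracket p lam (basisE p d) (basisE p a) b ^ 2
      = 12 * p * lam ^ 2 := by
    rw [← hS, Finset.sum_comm (f := fun d a => ∑ b, bracket p lam (basisE p d) (basisE p a) b ^ 2)]
    exact Finset.sum_congr rfl fun a _ => Finset.sum_comm
  have hS₂ : ∑ a, ∑ b, ∑ d, bracket p lam (basisE p b) (basisE p d) a ^ 2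
      = 12 * p * lam ^ 2 := by
    rw [← hS, Finset.sum_comm]
    exact Finset.sum_congr rfl fun b _ => Finset.sum_comm
  rw [hS, hS₁, hS₂]
  ring
end

section
/- For p = 1, define for i = 1, 2, 3 the 3-forms Tᵢ := ηᵢ∧dηᵢ − Σ_{j≠i} ηⱼ∧dηⱼ and the fundamental 2-forms Fᵢ(X, Y) := g_λ(X, φᵢY), and for a real number a set Sᵢ(a) := Tᵢ − 2a·ηᵢ∧Fᵢ. Then the three 3-forms S₁(a), S₂(a), S₃(a) coincide if and only if a = λ. (This is the existence and uniqueness of the cone constant making the cone over N₁ a hyper-Kähler manifold with torsion.) -/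
/-- The fundamental 2-form `Fᵢ(X,Y) = g_λ(X, φᵢY)`. -/
noncomputable def Fform (p : ℕ) (i : Fin 3) (X Y : NV p) : ℝ := gIP X (phi p i Y)

/-- The 3-form `Tᵢ = ηᵢ∧dηᵢ - Σ_{j≠i} ηⱼ∧dηⱼ` (for `p = 1`). -/
noncomputable def Ti3 (lam : ℝ) (i : Fin 3) (X Y Z : NV 1) : ℝ :=
  ∑ j : Fin 3, (if j = i then (1 : ℝ) else -1) *
    (X (zI 1 j) * dEta 1 lam j Y Z - Y (zI 1 j) * dEta 1 lam j X Z
      + Z (zI 1 j) * dEta 1 lam j X Y)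

/-- The 3-form `Sᵢ(a) = Tᵢ - 2a·ηᵢ∧Fᵢ` (for `p = 1`). -/
noncomputable def Sform (lam a : ℝ) (i : Fin 3) (X Y Z : NV 1) : ℝ :=
  Ti3 lam i X Y Z - 2 * a *
    (X (zI 1 i) * Fform 1 i Y Z - Y (zI 1 i) * Fform 1 i X Z + Z (zI 1 i) * Fform 1 i X Y)

/-- The horizontal part `ωᵢ` common to `dηᵢ` and `Fᵢ`: the component of the bracket along `ξᵢ`,
for `λ = 1`. -/
noncomputable def horizontalForm (i : Fin 3) (X Y : NV 1) : ℝ :=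
  bracket 1 1 X Y (zI 1 i)

lemma dEta_eq_horizontalForm (lam : ℝ) (i : Fin 3) (X Y : NV 1) :
    dEta 1 lam i X Y = -lam * horizontalForm i X Y := by
  fin_cases i <;>
    simp [dEta, horizontalForm, bracket, xi, zI]

lemma Fform_eq_horizontalForm (i : Fin 3) (X Y : NV 1) :
    Fform 1 i X Y = -horizontalForm i X Y - etaWedge 1 (i + 1) (i + 2) X Y := by
  fin_cases i <;>
    simp [Fform, gIP, phi, horizontalForm, bracket, etaWedge, xi, tau, zI, tI, Pi.single_apply,
      Fin.sum_univ_succ] <;>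
    ring

/-- The forms `Sᵢ(a)` differ by multiples of `a - λ`. -/
lemma Sform_eq (lam a : ℝ) (i : Fin 3) (X Y Z : NV 1) :
    Sform lam a i X Y Z =
      lam * ∑ j : Fin 3, (X (zI 1 j) * horizontalForm j Y Z - Y (zI 1 j) * horizontalForm j X Z
        + Z (zI 1 j) * horizontalForm j X Y)
      + 2 * (a - lam) * (X (zI 1 i) * horizontalForm i Y Z - Y (zI 1 i) * horizontalForm i X Z
        + Z (zI 1 i) * horizontalForm i X Y)
      + 2 * a * det3 1 X Y Z := by
  simp only [Sform, Ti3, dEta_eq_horizontalForm, Fform_eq_horizontalForm, etaWedge, det3,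
    Fin.sum_univ_three]
  fin_cases i <;> simp <;> ring

/-- the three 3-forms `S₁(a), S₂(a), S₃(a)` coincide if and only if `a = λ`
(existence and uniqueness of the cone constant for the HKT structure on the cone over `N₁`). -/
theorem quaternionic_heisenberg_cone_constant
    (lam : ℝ) (hlam : 0 < lam) :
    ∀ a : ℝ,
      ((∀ X Y Z : NV 1, Sform lam a 0 X Y Z = Sform lam a 1 X Y Z) ∧
        (∀ X Y Z : NV 1, Sform lam a 1 X Y Z = Sform lam a 2 X Y Z))
      ↔ a = lam := by
  intro a
  constructor
  · rintro ⟨h, -⟩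
    have h₀ := h (xi 1 0) (tau 1 0 0) (tau 1 1 0)
    simp only [Sform_eq] at h₀
    simp [horizontalForm, bracket, xi, tau, zI, tI, Pi.single_apply] at h₀
    linarith
  · rintro rfl
    simp [Sform_eq]
end
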